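/- arXiv:2012.11186 — 2 statements merged into one kernel-verified Lean document; each statement's English description precedes it below -/
import Mathlib

section
/- For every integer m ≥ 0, the quotient vector space V^{⊗m}/K_m is finite dimensional of dimension d_m. (Equivalently, dim K_m = (n+1)^m − d_m.) -/
open scoped TensorProduct

/-- `V = ℂ^{n+1}`. -/
abbrev Vsp (n : ℕ) : Type := Fin (n + 1) → ℂ

/-- The standard basis vector `e_k` of `ℂ^{n+1}`. -/
noncomputable def eVec (n : ℕ) (k : Fin (n + 1)) : Vsp n := Pi.single k 1

/-- The determinant vector `δ = ∑_{k=0}^{n} (−1)^k e_k ⊗ e_{n−k}`, viewed inside the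
second tensor power of `V`. -/
noncomputable def deltaVec (n : ℕ) : ⨂[ℂ]^2 (Vsp n) :=
  ∑ k : Fin (n + 1),
    ((-1 : ℂ) ^ (k : ℕ)) • PiTensorProduct.tprod ℂ ![eVec n k, eVec n k.rev]

/-- The product map `V^{⊗a} ⊗ V^{⊗b} ≃ V^{⊗(a+b)}`. -/
noncomputable def mulTP (n a b : ℕ) :
    (⨂[ℂ]^a (Vsp n)) ⊗[ℂ] (⨂[ℂ]^b (Vsp n)) ≃ₗ[ℂ] ⨂[ℂ]^(a + b) (Vsp n) :=
  (PiTensorProduct.tmulEquiv ℂ (Vsp n)).trans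
    (PiTensorProduct.reindex ℂ (fun _ => Vsp n) finSumFinEquiv)

/-- `K_m = ∑_{i=0}^{m-2} V^{⊗i} ⊗ ℂδ ⊗ V^{⊗(m−2−i)} ⊆ V^{⊗m}`: the span of all vectors
of the form `v ⊗ δ ⊗ w` with `v ∈ V^{⊗i}` and `w ∈ V^{⊗(m−2−i)}` (with `K_0 = K_1 = 0`). -/
noncomputable def Ksub (n m : ℕ) : Submodule ℂ (⨂[ℂ]^m (Vsp n)) :=
  Submodule.span ℂ
    {z : ⨂[ℂ]^m (Vsp n) | ∃ (i j : ℕ) (h : i + 2 + j = m)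
      (v : ⨂[ℂ]^i (Vsp n)) (w : ⨂[ℂ]^j (Vsp n)),
      z = (PiTensorProduct.reindex ℂ (fun _ => Vsp n) (finCongr h))
            ((mulTP n (i + 2) j)
              (((mulTP n i 2) (v ⊗ₜ[ℂ] deltaVec n)) ⊗ₜ[ℂ] w))}


section helpers

open PiTensorProduct

theorem abs_cancel (n : ℕ) (hn : 1 ≤ n) (T : ℕ → Type) [∀ m, AddCommGroup (T m)]
    [∀ m, Module ℂ (T m)]
    (Φ : ∀ m, (Fin (n + 1) → T m) ≃ₗ[ℂ] T (m + 1)) (K : ∀ m, Submodule ℂ (T m))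
    (K0 : K 0 = ⊥) (K1 : K 1 = ⊥)
    (hK : ∀ m z, z ∈ K (m + 2) ↔ ∃ b : T m, ∀ k : Fin (n + 1),
      (Φ (m + 1)).symm z k - (-1 : ℂ) ^ (k : ℕ) • Φ m (Pi.single k.rev b) ∈ K (m + 1)) :
    (∀ m (j : Fin (n + 1)) (x : T m), x ∈ K m → Φ m (Pi.single j x) ∈ K (m + 1)) ∧
    (∀ m (x : T m), Φ m (Pi.single (Fin.last n) x) ∈ K (m + 1) → x ∈ K m) := by
  have hmul : ∀ m (j : Fin (n + 1)) (x : T m), x ∈ K m → Φ m (Pi.single j x) ∈ K (m + 1) := by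
    intro m j x hx
    cases m with
    | zero =>
      rw [K0, Submodule.mem_bot] at hx
      subst hx
      simp
    | succ m =>
      rw [hK]
      refine ⟨0, fun k => ?_⟩
      simp only [LinearEquiv.symm_apply_apply, Pi.single_zero, map_zero, smul_zero, sub_zero]
      by_cases h : k = j
      · subst h; simpa using hx
      · simp [Pi.single_eq_of_ne h]
  refine ⟨hmul, ?_⟩
  intro m
  induction m with
  | zero =>
    intro x hx
    rw [K1, Submodule.mem_bot] at hx
    have := (Φ 0).map_eq_zero_iff.1 hx
    rw [Pi.single_eq_zero_iff] at this
    simp [this]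
  | succ m ih =>
    intro x hx
    rw [hK] at hx
    obtain ⟨b, hb⟩ := hx
    simp only [LinearEquiv.symm_apply_apply] at hb
    have hne : (0 : Fin (n + 1)) ≠ Fin.last n := by
      intro h
      have := congrArg Fin.val h
      simp at this
      omega
    have h0 := hb 0
    rw [Pi.single_eq_of_ne hne] at h0
    simp only [Fin.val_zero, pow_zero, one_smul, zero_sub, Fin.rev_zero, neg_mem_iff] at h0
    have hbK := ih b h0
    have hl := hb (Fin.last n)
    rw [Pi.single_eq_same] at hl
    have := (K (m + 1)).add_mem hl
      ((K (m + 1)).smul_mem ((-1 : ℂ) ^ ((Fin.last n : Fin (n + 1)) : ℕ))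
        (hmul m (Fin.last n).rev b hbK))
    simpa using this

theorem abs_rec (n : ℕ) (hn : 1 ≤ n) (T : ℕ → Type) [∀ m, AddCommGroup (T m)]
    [∀ m, Module ℂ (T m)] [∀ m, FiniteDimensional ℂ (T m)]
    (Φ : ∀ m, (Fin (n + 1) → T m) ≃ₗ[ℂ] T (m + 1)) (K : ∀ m, Submodule ℂ (T m))
    (K0 : K 0 = ⊥) (K1 : K 1 = ⊥)
    (hK : ∀ m z, z ∈ K (m + 2) ↔ ∃ b : T m, ∀ k : Fin (n + 1),
      (Φ (m + 1)).symm z k - (-1 : ℂ) ^ (k : ℕ) • Φ m (Pi.single k.rev b) ∈ K (m + 1)) (m : ℕ) :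
    Module.finrank ℂ (K (m + 2)) + Module.finrank ℂ (K m) =
      (n + 1) * Module.finrank ℂ (K (m + 1)) + Module.finrank ℂ (T m) := by
  obtain ⟨hmul, hcan⟩ := abs_cancel n hn T Φ K K0 K1 hK
  let D : T m →ₗ[ℂ] (Fin (n + 1) → T (m + 1)) := LinearMap.pi fun k =>
    (-1 : ℂ) ^ (k : ℕ) • ((Φ m).toLinearMap ∘ₗ LinearMap.single ℂ (fun _ => T m) k.rev)
  have hD : ∀ b k, D b k = (-1 : ℂ) ^ (k : ℕ) • Φ m (Pi.single k.rev b) := fun b k => rfl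
  have hDinj : Function.Injective D := by
    rw [← LinearMap.ker_eq_bot, LinearMap.ker_eq_bot']
    intro b hb
    have := congrFun hb 0
    rw [hD] at this
    simpa using this
  let P := LinearMap.compLeft (K (m + 1)).subtype (Fin (n + 1))
  have hPinj : Function.Injective P := by
    intro a b h
    funext k
    exact Subtype.ext (congrFun h k)
  have hP : ∀ y, y ∈ LinearMap.range P ↔ ∀ k, y k ∈ K (m + 1) := by
    intro y
    constructor
    · rintro ⟨a, rfl⟩ k
      exact (a k).2
    · intro h
      exact ⟨fun k => ⟨y k, h k⟩, rfl⟩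
  have e1 : (K (m + 2)).map (Φ (m + 1)).symm.toLinearMap
      = LinearMap.range P ⊔ LinearMap.range D := by
    ext y
    rw [Submodule.mem_sup]
    constructor
    · rintro ⟨z, hz, rfl⟩
      obtain ⟨b, hb⟩ := (hK m z).1 hz
      refine ⟨(Φ (m + 1)).symm z - D b, (hP _).2 hb, D b, ⟨b, rfl⟩, by simp⟩
    · rintro ⟨u, hu, _, ⟨b, rfl⟩, rfl⟩
      refine ⟨Φ (m + 1) (u + D b), (hK m _).2 ⟨b, fun k => ?_⟩, by simp⟩
      have := (hP u).1 hu k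
      simpa [hD] using this
  have e2 : LinearMap.range P ⊓ LinearMap.range D = (K m).map D := by
    ext y
    constructor
    · rintro ⟨h1, b, rfl⟩
      refine ⟨b, hcan m b ?_, rfl⟩
      have := (hP _).1 h1 0
      simpa [hD] using this
    · rintro ⟨b, hb, rfl⟩
      exact ⟨(hP _).2 fun k => Submodule.smul_mem _ _ (hmul m _ b hb), b, rfl⟩
  have h := Submodule.finrank_sup_add_finrank_inf_eq (LinearMap.range P) (LinearMap.range D)
  rw [← e1, e2, LinearMap.finrank_range_of_inj hPinj, LinearMap.finrank_range_of_inj hDinj,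
    LinearEquiv.finrank_map_eq, Module.finrank_pi_fintype,
    ← (Submodule.equivMapOfInjective D hDinj (K m)).finrank_eq] at h
  simpa using h

/-- Left multiplication by a vector. -/
noncomputable def Lmul (n m : ℕ) (x : Vsp n) : ⨂[ℂ]^m (Vsp n) →ₗ[ℂ] ⨂[ℂ]^(m + 1) (Vsp n) :=
  PiTensorProduct.lift ((tprod ℂ : MultilinearMap ℂ (fun _ : Fin (m + 1) => Vsp n) _).curryLeft x)

theorem Lmul_tprod (n m : ℕ) (x : Vsp n) (a : Fin m → Vsp n) :
    Lmul n m x (tprod ℂ a) = tprod ℂ (Fin.cons x a : Fin (m + 1) → Vsp n) := by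
  simp [Lmul]

noncomputable def PhiL (n m : ℕ) : (Fin (n + 1) → ⨂[ℂ]^m (Vsp n)) →ₗ[ℂ] ⨂[ℂ]^(m + 1) (Vsp n) :=
  ∑ k, Lmul n m (eVec n k) ∘ₗ LinearMap.proj k

theorem PhiL_apply (n m : ℕ) (x) : PhiL n m x = ∑ k, Lmul n m (eVec n k) (x k) := by
  simp [PhiL]

noncomputable def tbasis (n m : ℕ) : Module.Basis (Fin m → Fin (n + 1)) ℂ (⨂[ℂ]^m (Vsp n)) :=
  Basis.piTensorProduct (fun _ => Pi.basisFun ℂ (Fin (n + 1)))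

instance tfin (n m : ℕ) : FiniteDimensional ℂ (⨂[ℂ]^m (Vsp n)) :=
  Module.Finite.of_basis (tbasis n m)

theorem tfinrank (n m : ℕ) : Module.finrank ℂ (⨂[ℂ]^m (Vsp n)) = (n + 1) ^ m := by
  rw [Module.finrank_eq_card_basis (tbasis n m)]
  simp

theorem PhiL_surj (n m : ℕ) : Function.Surjective (PhiL n m) := by
  rw [← LinearMap.range_eq_top, eq_top_iff, ← (tbasis n (m + 1)).span_eq, Submodule.span_le]
  rintro _ ⟨p, rfl⟩
  refine ⟨Pi.single (p 0) (tprod ℂ fun i => eVec n (p i.succ)), ?_⟩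
  rw [PhiL_apply, Finset.sum_eq_single (p 0)]
  · rw [Pi.single_eq_same, Lmul_tprod, tbasis, Basis.piTensorProduct_apply]
    congr 1
    funext i
    refine Fin.cases ?_ (fun i => ?_) i <;> simp [eVec]
  · intro k _ hk
    simp [Pi.single_eq_of_ne hk]
  · simp

noncomputable def PhiE (n m : ℕ) : (Fin (n + 1) → ⨂[ℂ]^m (Vsp n)) ≃ₗ[ℂ] ⨂[ℂ]^(m + 1) (Vsp n) :=
  LinearEquiv.ofBijective (PhiL n m) ⟨by
    rw [LinearMap.injective_iff_surjective_of_finrank_eq_finrank]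
    · exact PhiL_surj n m
    · rw [Module.finrank_pi_fintype, tfinrank]
      simp [tfinrank, pow_succ, mul_comm], PhiL_surj n m⟩

theorem PhiE_apply (n m : ℕ) (x) : PhiE n m x = ∑ k, Lmul n m (eVec n k) (x k) :=
  PhiL_apply n m x

theorem PhiE_single (n m : ℕ) (k) (x) : PhiE n m (Pi.single k x) = Lmul n m (eVec n k) x := by
  rw [PhiE_apply, Finset.sum_eq_single k]
  · simp
  · intro j _ hj
    simp [Pi.single_eq_of_ne hj]
  · simp

/-- The generators of `Ksub`. -/
noncomputable def Gen (n : ℕ) {m : ℕ} (i j : ℕ) (h : i + 2 + j = m) (v : ⨂[ℂ]^i (Vsp n))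
    (w : ⨂[ℂ]^j (Vsp n)) : ⨂[ℂ]^m (Vsp n) :=
  (PiTensorProduct.reindex ℂ (fun _ => Vsp n) (finCongr h))
            ((mulTP n (i + 2) j)
              (((mulTP n i 2) (v ⊗ₜ[ℂ] deltaVec n)) ⊗ₜ[ℂ] w))

theorem mulTP_tprod (n a b : ℕ) (x : Fin a → Vsp n) (y : Fin b → Vsp n) :
    mulTP n a b (tprod ℂ x ⊗ₜ tprod ℂ y) = tprod ℂ (Fin.append x y) :=
  TensorPower.tprod_mul_tprod ℂ x y

theorem Gen_tprod (n : ℕ) {m : ℕ} (i j : ℕ) (h : i + 2 + j = m) (x : Fin i → Vsp n)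
    (y : Fin j → Vsp n) : Gen n i j h (tprod ℂ x) (tprod ℂ y) =
      ∑ k : Fin (n + 1), ((-1 : ℂ) ^ (k : ℕ)) • tprod ℂ
        (Fin.append (Fin.append x ![eVec n k, eVec n k.rev]) y ∘ Fin.cast h.symm) := by
  subst h
  simp only [Gen, deltaVec, TensorProduct.tmul_sum, TensorProduct.sum_tmul, map_sum]
  refine Finset.sum_congr rfl fun k _ => ?_
  rw [TensorProduct.tmul_smul, map_smul, ← TensorProduct.smul_tmul', map_smul, map_smul,
    mulTP_tprod, mulTP_tprod]
  congr 1
  exact TensorPower.cast_tprod ℂ (Vsp n) rfl _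

theorem Gen_Lmul (n : ℕ) {m : ℕ} (i j : ℕ) (h : i + 2 + j = m) (h' : i + 1 + 2 + j = m + 1)
    (u : Vsp n) (v : ⨂[ℂ]^i (Vsp n)) (w : ⨂[ℂ]^j (Vsp n)) :
    Gen n (i + 1) j h' (Lmul n i u v) w = Lmul n m u (Gen n i j h v w) := by
  induction v using PiTensorProduct.induction_on with
  | add a b ha hb =>
    simp only [Gen, map_add, TensorProduct.add_tmul] at *
    rw [ha, hb]
  | smul_tprod r x =>
    induction w using PiTensorProduct.induction_on with
    | add a b ha hb =>
      simp only [Gen, map_add, TensorProduct.tmul_add] at *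
      rw [ha, hb]
    | smul_tprod s y =>
      have key : Gen n (i + 1) j h' (Lmul n i u (tprod ℂ x)) (tprod ℂ y)
          = Lmul n m u (Gen n i j h (tprod ℂ x) (tprod ℂ y)) := by
        subst h
        rw [Lmul_tprod, Gen_tprod, Gen_tprod, map_sum]
        refine Finset.sum_congr rfl fun k _ => ?_
        rw [map_smul, Lmul_tprod]
        congr 2
        rw [Fin.append_cons, Fin.append_cast_left, Fin.append_cons]
        funext t
        refine Fin.cases ?_ (fun t => ?_) t <;> rfl
      simp only [Gen, map_smul, TensorProduct.tmul_smul, ← TensorProduct.smul_tmul'] at *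
      rw [key]

theorem Gen_zero (n : ℕ) {m : ℕ} (h : 0 + 2 + m = m + 2)
    (x : Fin 0 → Vsp n) (w : ⨂[ℂ]^m (Vsp n)) :
    Gen n 0 m h (tprod ℂ x) w = ∑ k : Fin (n + 1), ((-1 : ℂ) ^ (k : ℕ)) •
      Lmul n (m + 1) (eVec n k) (Lmul n m (eVec n k.rev) w) := by
  induction w using PiTensorProduct.induction_on with
  | add a b ha hb =>
    simp only [Gen, map_add, TensorProduct.tmul_add, smul_add, Finset.sum_add_distrib] at *
    rw [ha, hb]
  | smul_tprod s y =>
    have key := Gen_tprod n 0 m h x y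
    have : Gen n 0 m h (tprod ℂ x) (s • tprod ℂ y) = s • Gen n 0 m h (tprod ℂ x) (tprod ℂ y) := by
      simp only [Gen, map_smul, TensorProduct.tmul_smul]
    rw [this, key, Finset.smul_sum]
    refine Finset.sum_congr rfl fun k _ => ?_
    rw [map_smul, map_smul, Lmul_tprod, Lmul_tprod, smul_comm]
    congr 3
    have e : Fin.append x ![eVec n k, eVec n k.rev]
        = (Fin.cons (eVec n k) (Fin.cons (eVec n k.rev) (Fin.elim0 : Fin 0 → Vsp n) :
            Fin 1 → Vsp n) : Fin 2 → Vsp n) ∘ Fin.cast (Nat.zero_add 2) :=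
      Fin.append_left_nil x _ rfl
    rw [e, Fin.append_cast_left, Fin.append_cons, Fin.append_cons, Fin.elim0_append]
    funext t
    refine Fin.cases ?_ (fun t => Fin.cases ?_ (fun t => ?_) t) t
    · rfl
    · rfl
    · simp only [Function.comp_apply, Fin.cons_succ]
      rfl

theorem Ksub_lt (n m : ℕ) (hm : m < 2) : Ksub n m = ⊥ := by
  rw [Ksub, Submodule.span_eq_bot]
  rintro z ⟨i, j, h, _⟩
  omega

theorem Gen_mem (n : ℕ) {m : ℕ} (i j : ℕ) (h : i + 2 + j = m) (v : ⨂[ℂ]^i (Vsp n))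
    (w : ⨂[ℂ]^j (Vsp n)) : Gen n i j h v w ∈ Ksub n m :=
  Submodule.subset_span ⟨i, j, h, v, w, rfl⟩

theorem Ksub_Lmul (n m : ℕ) (u : Vsp n) (z) (hz : z ∈ Ksub n m) : Lmul n m u z ∈ Ksub n (m + 1) := by
  rw [Ksub] at hz
  induction hz using Submodule.span_induction with
  | mem x h =>
    obtain ⟨i, j, h, v, w, rfl⟩ := h
    change Lmul n m u (Gen n i j h v w) ∈ _
    rw [← Gen_Lmul n i j h (by omega)]
    exact Gen_mem _ _ _ _ _ _
  | zero => simp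
  | add x y _ _ hx hy => rw [map_add]; exact add_mem hx hy
  | smul a x _ hx => rw [map_smul]; exact Submodule.smul_mem _ _ hx

theorem Ksub_rec (n m : ℕ) (z) : z ∈ Ksub n (m + 2) ↔ ∃ b : ⨂[ℂ]^m (Vsp n), ∀ k : Fin (n + 1),
      (PhiE n (m + 1)).symm z k - (-1 : ℂ) ^ (k : ℕ) • PhiE n m (Pi.single k.rev b)
        ∈ Ksub n (m + 1) := by
  simp only [PhiE_single]
  constructor
  · intro hz
    rw [Ksub] at hz
    induction hz using Submodule.span_induction with
    | mem x h =>
      obtain ⟨i, j, h, v, w, rfl⟩ := h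
      change ∃ b : ⨂[ℂ]^m (Vsp n), ∀ k : Fin (n + 1),
        (PhiE n (m + 1)).symm (Gen n i j h v w) k - _ ∈ _
      cases i with
      | zero =>
        obtain rfl : j = m := by omega
        induction v using PiTensorProduct.induction_on with
        | add a c ha hc =>
          obtain ⟨b1, h1⟩ := ha
          obtain ⟨b2, h2⟩ := hc
          refine ⟨b1 + b2, fun k => ?_⟩
          have := add_mem (h1 k) (h2 k)
          have e : Gen n 0 j h (a + c) w = Gen n 0 j h a w + Gen n 0 j h c w := by
            simp only [Gen, map_add, TensorProduct.add_tmul]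
          rw [e]
          convert this using 1
          simp only [map_add, Pi.add_apply, smul_add]
          abel
        | smul_tprod r x =>
          refine ⟨r • w, fun k => ?_⟩
          have e : Gen n 0 j h (r • tprod ℂ x) w = PhiE n (j + 1) (fun k =>
              (-1 : ℂ) ^ (k : ℕ) • Lmul n j (eVec n k.rev) (r • w)) := by
            have e1 : Gen n 0 j h (r • tprod ℂ x) w = Gen n 0 j h (tprod ℂ x) (r • w) := by
              simp only [Gen, map_smul, TensorProduct.tmul_smul, ← TensorProduct.smul_tmul']
            rw [e1, Gen_zero, PhiE_apply]
            simp
          rw [e]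
          simp
      | succ i =>
        refine ⟨0, fun k => ?_⟩
        obtain ⟨y, rfl⟩ := (PhiE n i).surjective v
        have e : Gen n (i + 1) j h (PhiE n i y) w = PhiE n (m + 1) (fun k =>
            Gen n i j (by omega) (y k) w) := by
          rw [PhiE_apply, PhiE_apply]
          simp only [← Gen_Lmul n i j (show i + 2 + j = m + 1 by omega) h]
          simp only [Gen, map_sum, TensorProduct.sum_tmul]
        rw [e]
        simpa using Gen_mem n i j (by omega) (y k) w
    | zero => exact ⟨0, fun k => by simp⟩
    | add x y _ _ hx hy =>
      obtain ⟨b1, h1⟩ := hx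
      obtain ⟨b2, h2⟩ := hy
      refine ⟨b1 + b2, fun k => ?_⟩
      convert add_mem (h1 k) (h2 k) using 1
      simp only [map_add, Pi.add_apply, smul_add]
      abel
    | smul a x _ hx =>
      obtain ⟨b1, h1⟩ := hx
      refine ⟨a • b1, fun k => ?_⟩
      convert Submodule.smul_mem _ a (h1 k) using 1
      simp only [map_smul, Pi.smul_apply, smul_sub]
      rw [smul_comm]
  · rintro ⟨b, hb⟩
    obtain ⟨y, rfl⟩ := (PhiE n (m + 1)).surjective z
    simp only [LinearEquiv.symm_apply_apply] at hb
    have e : PhiE n (m + 1) y = ∑ k, Lmul n (m + 1) (eVec n k)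
        (y k - (-1 : ℂ) ^ (k : ℕ) • Lmul n m (eVec n k.rev) b)
        + Gen n 0 m (by omega) (tprod ℂ Fin.elim0) b := by
      rw [Gen_zero, PhiE_apply, ← Finset.sum_add_distrib]
      refine Finset.sum_congr rfl fun k _ => ?_
      simp
    rw [e]
    exact add_mem (Submodule.sum_mem _ fun k _ => Ksub_Lmul _ _ _ _ (hb k)) (Gen_mem _ _ _ _ _ _)

theorem Ksub_finrank (n : ℕ) (hn : 1 ≤ n) (d : ℤ → ℤ)
    (h0 : d 0 = 1) (h1 : d 1 = (n : ℤ) + 1)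
    (hrec : ∀ m : ℤ, 2 ≤ m → d m = ((n : ℤ) + 1) * d (m - 1) - d (m - 2)) (m : ℕ) :
    (Module.finrank ℂ (Ksub n m) : ℤ) = ((n : ℤ) + 1) ^ m - d (m : ℤ) := by
  induction m using Nat.twoStepInduction with
  | zero => rw [Ksub_lt n 0 (by omega)]; simp [h0]
  | one => rw [Ksub_lt n 1 (by omega)]; simp [h1]
  | more m ih1 ih2 =>
    have := abs_rec n hn (fun m => ⨂[ℂ]^m (Vsp n)) (PhiE n) (Ksub n) (Ksub_lt n 0 (by omega))
      (Ksub_lt n 1 (by omega)) (Ksub_rec n) m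
    rw [tfinrank] at this
    have h2 : (Module.finrank ℂ (Ksub n (m + 2)) : ℤ) + Module.finrank ℂ (Ksub n m) =
      (n + 1) * Module.finrank ℂ (Ksub n (m + 1)) + (n + 1) ^ m := by exact_mod_cast this
    have h3 := hrec ((m + 2 : ℕ) : ℤ) (by push_cast; omega)
    have a1 : ((m + 2 : ℕ) : ℤ) - 1 = ((m + 1 : ℕ) : ℤ) := by push_cast; ring
    have a2 : ((m + 2 : ℕ) : ℤ) - 2 = (m : ℤ) := by push_cast; ring
    rw [a1, a2] at h3
    rw [ih1, ih2] at h2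
    rw [h3]
    linear_combination h2

end helpers

/-- For every `m ≥ 0`, the quotient `V^{⊗m}/K_m` is finite dimensional of dimension `d_m`;
equivalently, `dim K_m = (n+1)^m − d_m`. -/
theorem stmt_12 (n : ℕ) (hn : 1 ≤ n) (d : ℤ → ℤ)
    (hneg : d (-1) = 0) (h0 : d 0 = 1) (h1 : d 1 = (n : ℤ) + 1)
    (hrec : ∀ m : ℤ, 2 ≤ m → d m = ((n : ℤ) + 1) * d (m - 1) - d (m - 2)) :
    ∀ m : ℕ,
      FiniteDimensional ℂ ((⨂[ℂ]^m (Vsp n)) ⧸ Ksub n m) ∧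
      (Module.finrank ℂ ((⨂[ℂ]^m (Vsp n)) ⧸ Ksub n m) : ℤ) = d (m : ℤ) ∧
      (Module.finrank ℂ (Ksub n m) : ℤ) = ((n : ℤ) + 1) ^ m - d (m : ℤ) := by
  intro m
  have hk := Ksub_finrank n hn d h0 h1 hrec m
  refine ⟨inferInstance, ?_, hk⟩
  have hq := (Ksub n m).finrank_quotient_add_finrank
  rw [tfinrank] at hq
  have hq2 : (Module.finrank ℂ ((⨂[ℂ]^m (Vsp n)) ⧸ Ksub n m) : ℤ)
      + Module.finrank ℂ (Ksub n m) = ((n : ℤ) + 1) ^ m := by exact_mod_cast hq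
  rw [hk] at hq2
  linarith
end

section
/- Let X be a complex Hilbert space, let x, y : X → X be bounded operators, and suppose there is a dense linear subspace 𝒳 ⊆ X such that 𝒳 ⊆ Im(y*y) and x(𝒳), x*(𝒳), y*(𝒳) ⊆ 𝒳. Suppose K : X → X is a positive compact operator and L, L̄, M, M̄ : X → X are bounded operators such that K^{1/2} L K^{1/2} = [x, y], K^{1/2} L̄ K^{1/2} = [x, y*], M K = [x, y] and K M̄ = [x, y*]. Suppose finally that there exists a constant C > 0 such that ‖K^{1/2}(λ + y*y)^{−1/2}‖ ≤ C, ‖K(λ + y*y)^{−1}‖ ≤ C and ‖K^{1/2} y (λ + y*y)^{−1}‖ ≤ C for all λ > 0. Then the (densely defined) operator y|y|^{−1} : Im(|y|) → X extends to a bounded linear isometry θ : X → X, and both commutators [x, θ] and [x*, θ] are compact operators on X. -/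
open ContinuousLinearMap

section Helpers

open MeasureTheory Set

lemma aux_integral_compact {X : Type*}
    [NormedAddCommGroup X] [InnerProductSpace ℂ X] [CompleteSpace X]
    (μ : Measure ℝ) (F : ℝ → (X →L[ℂ] X)) (hF : IntegrableOn F (Ioi 0) μ)
    (hc : ∀ t : ℝ, 0 < t → IsCompactOperator (F t)) :
    IsCompactOperator (∫ t in Ioi 0, F t ∂μ : X →L[ℂ] X) := by
  let S : Submodule ℂ (X →L[ℂ] X) := compactOperator (RingHom.id ℂ) X X
  have hS : IsClosed (S : Set (X →L[ℂ] X)) := isClosed_setOfPred_isCompactOperator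
  have : IsClosed (S.toAddSubgroup : Set (X →L[ℂ] X)) := hS
  have h1 := (S.mkQL).integral_comp_comm hF
  have h2 : ∫ t in Ioi 0, S.mkQL (F t) ∂μ = 0 := by
    refine setIntegral_eq_zero_of_forall_eq_zero fun t ht => ?_
    exact (Submodule.Quotient.mk_eq_zero S).2 (hc t ht)
  rw [h2] at h1
  exact (Submodule.Quotient.mk_eq_zero S).1 h1.symm

lemma aux_cfc {A : Type*} [CStarAlgebra A] [PartialOrder A] [StarOrderedRing A]
    {p t : ℝ} (hp : p ∈ Ioo 0 1) (ht : 0 < t) (a R : A) (ha : 0 ≤ a)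
    (hR : R * (t • (1 : A) + a) = 1) :
    cfcₙ (Real.rpowIntegrand₀₁ p t) a = t ^ (p - 1) • (R * a) := by
  have hspec : ∀ r ∈ spectrum ℝ a, 0 ≤ r := fun r hr => spectrum_nonneg_of_nonneg ha hr
  have hcont : ContinuousOn (Real.rpowIntegrand₀₁ p t) (spectrum ℝ a) :=
    (Real.continuousOn_rpowIntegrand₀₁_Ici hp ht).mono hspec
  have hq : ContinuousOn (Real.rpowIntegrand₀₁ p t) (quasispectrum ℝ a) :=
    (Real.continuousOn_rpowIntegrand₀₁_Ici hp ht).mono (fun r hr => quasispectrum_nonneg_of_nonneg a ha r hr)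
  have hsa : IsSelfAdjoint a := ha.isSelfAdjoint
  rw [cfcₙ_eq_cfc hq (by simp)]
  have h1 : cfc (fun r : ℝ => (t + r) * Real.rpowIntegrand₀₁ p t r) a = t ^ (p - 1) • a := by
    rw [← cfc_smul_id (R := ℝ) (t ^ (p - 1)) a]
    refine cfc_congr fun r hr => ?_
    have := hspec r hr
    simp only [Real.rpowIntegrand₀₁_eq_pow_div hp ht.le this, smul_eq_mul]
    field_simp
  rw [cfc_mul (fun r : ℝ => t + r) _ a (by fun_prop) hcont, 
    cfc_const_add t (fun r => r) a (by fun_prop), cfc_id' ℝ a,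
    Algebra.algebraMap_eq_smul_one] at h1
  rw [← mul_smul_comm, ← h1, ← mul_assoc, hR, one_mul]

lemma aux_bounds {X : Type*}
    [NormedAddCommGroup X] [InnerProductSpace ℂ X] [CompleteSpace X]
    (y S : X →L[ℂ] X) (t : ℝ) (ht : 0 < t) (h : star (y * S) * (y * S) + t • (star S * S) = 1) :
    ‖y * S‖ ≤ 1 ∧ t * ‖S‖ ^ 2 ≤ 1 := by
  have key : ∀ ζ : X, ‖(y * S) ζ‖ ^ 2 + t * ‖S ζ‖ ^ 2 = ‖ζ‖ ^ 2 := by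
    intro ζ
    have := congrArg (fun T : X →L[ℂ] X => RCLike.re (inner ℂ (T ζ) ζ)) h
    simp only [star_eq_adjoint, add_apply, mul_apply_eq_comp, FunLike.coe_smul, Pi.smul_apply,
      inner_add_left, adjoint_inner_left, map_add, one_apply_eq_self] at this
    rw [← Complex.coe_smul, inner_smul_left, adjoint_inner_left] at this
    simp only [inner_self_eq_norm_sq_to_K] at this
    norm_cast at this
    have e : ((‖S ζ‖ : ℂ) ^ 2).re = ‖S ζ‖ ^ 2 := by norm_cast
    simpa [e] using this
  constructor
  · refine opNorm_le_bound _ zero_le_one fun ζ => ?_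
    rw [one_mul]
    refine le_of_sq_le_sq ?_ (norm_nonneg _)
    nlinarith [key ζ, mul_nonneg ht.le (sq_nonneg ‖S ζ‖)]
  · have : ‖S‖ ≤ (Real.sqrt t)⁻¹ := by
      refine opNorm_le_bound _ (by positivity) fun ζ => ?_
      rw [inv_mul_eq_div, le_div_iff₀ (by positivity)]
      refine le_of_sq_le_sq ?_ (norm_nonneg _)
      rw [mul_pow, Real.sq_sqrt ht.le]
      nlinarith [key ζ, sq_nonneg ‖(y * S) ζ‖]
    calc t * ‖S‖ ^ 2 ≤ t * ((Real.sqrt t)⁻¹) ^ 2 := by gcongr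
      _ = 1 := by rw [inv_pow, Real.sq_sqrt ht.le]; field_simp

lemma aux_compact {X : Type*}
    [NormedAddCommGroup X] [InnerProductSpace ℂ X] [CompleteSpace X]
    (P M K Mbar Q : X →L[ℂ] X) {R : X →L[ℂ] X} (hK : IsCompactOperator K) :
    IsCompactOperator (P * (M * K) * R - Q * (K * Mbar) * Q : X →L[ℂ] X) := by
  have c1 : IsCompactOperator ((P ∘L M) ∘L K ∘L R : X →L[ℂ] X) :=
    (hK.comp_clm R).clm_comp (P ∘L M)
  have c2 : IsCompactOperator (Q ∘L K ∘L (Mbar ∘L Q) : X →L[ℂ] X) :=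
    (hK.comp_clm (Mbar ∘L Q)).clm_comp Q
  exact c1.sub c2

set_option maxHeartbeats 2000000 in
lemma aux_key {X : Type*}
    [NormedAddCommGroup X] [InnerProductSpace ℂ X] [CompleteSpace X]
    (x y : X →L[ℂ] X)
    (𝒳 : Submodule ℂ X) (hdense : Dense (𝒳 : Set X))
    (hrange : ∀ ξ ∈ 𝒳, ∃ η, (star y * y) η = ξ)
    (hx𝒳 : ∀ ξ ∈ 𝒳, x ξ ∈ 𝒳)
    (K : X →L[ℂ] X) (hKcpt : IsCompactOperator K)
    (sqrtK : X →L[ℂ] X) (hsqrtKsa : star sqrtK = sqrtK)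
    (absY : X →L[ℂ] X) (habsYpos : absY.IsPositive)
    (habsY : absY * absY = star y * y)
    (Lbar M Mbar : X →L[ℂ] X)
    (hLbar : sqrtK * Lbar * sqrtK = x * star y - star y * x)
    (hM : M * K = x * y - y * x)
    (hMbar : K * Mbar = x * star y - star y * x)
    (R S : ℝ → (X →L[ℂ] X))
    (hR1 : ∀ t : ℝ, 0 < t → (t • (1 : X →L[ℂ] X) + star y * y) * R t = 1)
    (hR2 : ∀ t : ℝ, 0 < t → R t * (t • (1 : X →L[ℂ] X) + star y * y) = 1)
    (hSsa : ∀ t : ℝ, 0 < t → star (S t) = S t)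
    (hSS : ∀ t : ℝ, 0 < t → S t * S t = R t)
    (C : ℝ) (hC : 0 < C)
    (hb1 : ∀ t : ℝ, 0 < t → ‖sqrtK * S t‖ ≤ C)
    (hb2 : ∀ t : ℝ, 0 < t → ‖K * R t‖ ≤ C)
    (hb3 : ∀ t : ℝ, 0 < t → ‖sqrtK * y * R t‖ ≤ C)
    (θ : X →L[ℂ] X) (hθ : θ * absY = y) :
    IsCompactOperator (x * θ - θ * x : X →L[ℂ] X) := by
  obtain ⟨μ, hμ⟩ := CFC.exists_measure_nnrpow_eq_integral_cfcₙ_rpowIntegrand₀₁ (X →L[ℂ] X)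
    (p := 1 / 2) ⟨by simp, by rw [div_lt_one] <;> norm_num⟩
  have hp : (((1 / 2 : NNReal) : ℝ)) ∈ Ioo (0 : ℝ) 1 := by constructor <;> norm_num
  set p : ℝ := ((1 / 2 : NNReal) : ℝ) with hpdef
  have ha : (0 : X →L[ℂ] X) ≤ star y * y := star_mul_self_nonneg y
  have habs0 : (0 : X →L[ℂ] X) ≤ absY := (nonneg_iff_isPositive _).2 habsYpos
  -- integral representation of the absolute value
  have hI : IntegrableOn (fun t => t ^ (p - 1) • (R t * (star y * y))) (Ioi 0) μ := by
    refine (hμ _ ha).1.congr_fun (fun t ht => ?_) measurableSet_Ioi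
    exact aux_cfc hp ht _ _ ha (hR2 t ht)
  have hIeq : absY = ∫ t in Ioi 0, t ^ (p - 1) • (R t * (star y * y)) ∂μ := by
    have h1 : (star y * y) ^ (1 / 2 : NNReal) = absY := by
      rw [← CFC.sqrt_eq_nnrpow]; exact CFC.sqrt_unique habsY habs0
    rw [← h1, (hμ _ ha).2]
    refine setIntegral_congr_fun measurableSet_Ioi fun t ht => ?_
    exact aux_cfc hp ht _ _ ha (hR2 t ht)
  have hone : IntegrableOn (fun t : ℝ => t ^ (p - 1) • ((t + 1)⁻¹ • (1 : X →L[ℂ] X))) (Ioi 0) μ := by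
    refine (hμ 1 (mem_Ici.2 zero_le_one)).1.congr_fun (fun t ht => ?_) measurableSet_Ioi
    have ht : 0 < t := ht
    beta_reduce
    rw [aux_cfc hp ht 1 ((t + 1)⁻¹ • (1 : X →L[ℂ] X)) zero_le_one, mul_one]
    have e : t • (1 : X →L[ℂ] X) + 1 = (t + 1) • (1 : X →L[ℂ] X) := by rw [add_smul, one_smul]
    rw [e, smul_mul_smul_comm, inv_mul_cancel₀ (by positivity)]
    simp
  -- the commutator integrand
  set G : ℝ → (X →L[ℂ] X) := fun t => x * (y * R t) - (y * R t) * x with hG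
  set T1 := x * y - y * x with hT1
  set T2 := x * star y - star y * x with hT2
  have hGeq : ∀ t : ℝ, 0 < t →
      G t = (1 - y * R t * star y) * T1 * R t - y * R t * T2 * (y * R t) := by
    intro t ht
    have e1 : x * R t = R t * (t • (1 : X →L[ℂ] X) + star y * y) * (x * R t) := by
      rw [hR2 t ht, one_mul]
    have e2 : R t * x = R t * x * ((t • (1 : X →L[ℂ] X) + star y * y) * R t) := by
      rw [hR1 t ht, mul_one]
    have e3 : x * R t - R t * x = - (R t * (T2 * y + star y * T1) * R t) := by
      rw [e1, e2, hT1, hT2]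
      simp only [mul_add, add_mul, mul_sub, sub_mul, mul_smul_comm, smul_mul_assoc, mul_one,
        one_mul, mul_assoc]
      abel
    have e4 : G t = T1 * R t + y * (x * R t - R t * x) := by
      simp only [hG, hT1]; noncomm_ring
    rw [e4, e3]
    noncomm_ring
  have hGcpt : ∀ t : ℝ, 0 < t → IsCompactOperator (G t) := by
    intro t ht
    rw [hGeq t ht, ← hM, ← hMbar]
    exact aux_compact (1 - y * R t * star y) M K Mbar (y * R t) hKcpt
  have hbd : ∀ t : ℝ, 0 < t → ‖y * S t‖ ≤ 1 ∧ t * ‖S t‖ ^ 2 ≤ 1 := by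
    intro t ht
    refine aux_bounds y (S t) t ht ?_
    have hcomm : S t * R t = R t * S t := by rw [← hSS t ht, mul_assoc]
    have h2 : S t * (t • (1 : X →L[ℂ] X) + star y * y) =
        (t • (1 : X →L[ℂ] X) + star y * y) * S t := by
      calc S t * (t • (1 : X →L[ℂ] X) + star y * y)
          = ((t • (1 : X →L[ℂ] X) + star y * y) * R t) * S t
            * (t • (1 : X →L[ℂ] X) + star y * y) := by rw [hR1 t ht, one_mul]
        _ = (t • (1 : X →L[ℂ] X) + star y * y) * S t
            * (R t * (t • (1 : X →L[ℂ] X) + star y * y)) := by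
            rw [mul_assoc _ (R t) (S t), ← hcomm]; noncomm_ring
        _ = _ := by rw [hR2 t ht, mul_one]
    have h3 : S t * (t • (1 : X →L[ℂ] X) + star y * y) * S t = 1 := by
      rw [h2, mul_assoc, hSS t ht, hR1 t ht]
    rw [star_mul, hSsa t ht, ← h3]
    simp only [mul_add, add_mul, mul_smul_comm, smul_mul_assoc, mul_one, mul_assoc]
    abel
  have hyR : ∀ t : ℝ, 0 < t → ‖y * R t‖ ≤ ‖S t‖ := by
    intro t ht
    rw [← hSS t ht, ← mul_assoc]
    calc _ ≤ ‖y * S t‖ * ‖S t‖ := norm_mul_le _ _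
      _ ≤ 1 * ‖S t‖ := by gcongr; exact (hbd t ht).1
      _ = _ := one_mul _
  have hRn : ∀ t : ℝ, 0 < t → ‖R t‖ ≤ ‖S t‖ ^ 2 := by
    intro t ht
    rw [← hSS t ht, sq]; exact norm_mul_le _ _
  have hone' : ∀ t : ℝ, 0 < t → ∀ Z : X →L[ℂ] X, ‖(1 - y * R t * star y) * Z‖ ≤ 2 * ‖Z‖ := by
    intro t ht Z
    have e : y * R t * star y = (y * S t) * star (y * S t) := by
      rw [← hSS t ht, star_mul, hSsa t ht]; noncomm_ring
    have h1 : ‖y * R t * star y‖ ≤ 1 := by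
      rw [e]
      calc _ ≤ ‖y * S t‖ * ‖star (y * S t)‖ := norm_mul_le _ _
        _ ≤ 1 * 1 := by
            rw [norm_star]; gcongr <;> exact (hbd t ht).1
        _ = 1 := one_mul _
    rw [sub_mul, one_mul]
    calc _ ≤ ‖Z‖ + ‖y * R t * star y * Z‖ := norm_sub_le _ _
      _ ≤ ‖Z‖ + ‖y * R t * star y‖ * ‖Z‖ := by gcongr; exact norm_mul_le _ _
      _ ≤ ‖Z‖ + 1 * ‖Z‖ := by gcongr
      _ = _ := by ring
  set B1 := 2 * (‖M‖ * C) + C * ‖Lbar‖ * C with hB1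
  set B2 := 2 * ‖T1‖ + ‖T2‖ with hB2
  have hGb1 : ∀ t : ℝ, 0 < t → ‖G t‖ ≤ B1 := by
    intro t ht
    rw [hGeq t ht]
    refine (norm_sub_le _ _).trans (add_le_add ?_ ?_)
    · rw [mul_assoc]
      refine (hone' t ht _).trans ?_
      rw [← hM, mul_assoc]
      gcongr
      refine (norm_mul_le _ _).trans ?_
      gcongr
      exact hb2 t ht
    · rw [← hLbar]
      have e : y * R t * (sqrtK * Lbar * sqrtK) * (y * R t) =
          ((y * S t) * star (sqrtK * S t)) * Lbar * (sqrtK * y * R t) := by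
        rw [← hSS t ht, star_mul, hSsa t ht, hsqrtKsa]; noncomm_ring
      rw [e]
      refine (norm_mul_le _ _).trans ?_
      gcongr
      · refine (norm_mul_le _ _).trans ?_
        gcongr
        refine (norm_mul_le _ _).trans ?_
        rw [norm_star, ← one_mul C]
        gcongr
        · exact (hbd t ht).1
        · exact hb1 t ht
      · exact hb3 t ht
  have hGb2 : ∀ t : ℝ, 0 < t → t * ‖G t‖ ≤ B2 := by
    intro t ht
    have hs := (hbd t ht).2
    have h1 : ‖G t‖ ≤ B2 * ‖S t‖ ^ 2 := by
      rw [hGeq t ht, hB2, add_mul]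
      refine (norm_sub_le _ _).trans (add_le_add ?_ ?_)
      · rw [mul_assoc]
        refine (hone' t ht _).trans ?_
        rw [mul_assoc]
        gcongr
        refine (norm_mul_le _ _).trans ?_
        gcongr
        exact hRn t ht
      · calc _ ≤ ‖y * R t * T2‖ * ‖y * R t‖ := norm_mul_le _ _
          _ ≤ (‖y * R t‖ * ‖T2‖) * ‖y * R t‖ := by gcongr; exact norm_mul_le _ _
          _ ≤ (‖S t‖ * ‖T2‖) * ‖S t‖ := by gcongr <;> exact hyR t ht
          _ = _ := by ring
    have hB2' : 0 ≤ B2 := by positivity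
    calc t * ‖G t‖ ≤ t * (B2 * ‖S t‖ ^ 2) := by gcongr
      _ = B2 * (t * ‖S t‖ ^ 2) := by ring
      _ ≤ B2 * 1 := by gcongr
      _ = B2 := mul_one _
  -- continuity of the resolvent
  have hRcont : ContinuousOn R (Ioi 0) := by
    have h1 : ∀ t : ℝ, 0 < t → R t = Ring.inverse (t • (1 : X →L[ℂ] X) + star y * y) := by
      intro t ht
      exact (Ring.inverse_unit ⟨_, R t, hR1 t ht, hR2 t ht⟩).symm
    have h2 : ContinuousOn (fun t : ℝ => Ring.inverse (t • (1 : X →L[ℂ] X) + star y * y))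
        (Ioi 0) := by
      intro t ht
      have := NormedRing.inverse_continuousAt
        (⟨_, R t, hR1 t ht, hR2 t ht⟩ : (X →L[ℂ] X)ˣ)
      refine ContinuousAt.continuousWithinAt ?_
      refine ContinuousAt.comp (f := fun t : ℝ => t • (1 : X →L[ℂ] X) + star y * y) this ?_
      fun_prop
    exact h2.congr h1
  set F : ℝ → (X →L[ℂ] X) := fun t => t ^ (p - 1) • G t with hF
  have hFcont : ContinuousOn F (Ioi 0) := by
    have h₀ : ContinuousOn (fun t : ℝ => t ^ (p - 1)) (Ioi 0) :=
      .rpow_const (by fun_prop) fun t ht => .inl (ne_of_gt ht)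
    simp only [hF, hG]
    fun_prop
  have hFint : IntegrableOn F (Ioi 0) μ := by
    refine Integrable.mono' (hone.norm.const_mul (B1 + B2))
      (hFcont.aestronglyMeasurable measurableSet_Ioi) ?_
    filter_upwards [ae_restrict_mem measurableSet_Ioi] with t ht
    have ht : 0 < t := ht
    have hb : ‖G t‖ ≤ (B1 + B2) * (t + 1)⁻¹ := by
      rw [← div_eq_mul_inv, le_div_iff₀ (by positivity)]
      linarith [hGb1 t ht, hGb2 t ht]
    have h1 : ‖G t‖ ≤ ‖G t‖ * ‖(1 : X →L[ℂ] X)‖ := by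
      simpa using norm_mul_le (G t) 1
    simp only [hF, norm_smul]
    rw [Real.norm_of_nonneg (inv_nonneg.2 (by positivity : 0 ≤ t + 1))]
    calc _ ≤ ‖t ^ (p - 1)‖ * (((B1 + B2) * (t + 1)⁻¹) * ‖(1 : X →L[ℂ] X)‖) := by
          gcongr
          exact h1.trans (by gcongr)
      _ = _ := by ring
  have hcpt := aux_integral_compact μ F hFint
    (fun t ht => (hGcpt t ht).smul (t ^ (p - 1) : ℝ))
  have hθ' : ∀ ζ, θ (absY ζ) = y ζ := fun ζ => by rw [← hθ]; rfl
  -- strong form of the integral representation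
  have happ : ∀ η, absY η = ∫ t in Ioi 0, t ^ (p - 1) • R t ((star y * y) η) ∂μ := by
    intro η
    conv_lhs => rw [hIeq]
    rw [ContinuousLinearMap.integral_apply hI]
    rfl
  have hint : ∀ η, IntegrableOn (fun t => t ^ (p - 1) • R t ((star y * y) η)) (Ioi 0) μ := by
    intro η
    exact hI.apply_continuousLinearMap η
  have hfin : x * θ - θ * x = ∫ t in Ioi 0, F t ∂μ := by
    refine ContinuousLinearMap.coeFn_injective ?_
    refine Continuous.ext_on hdense (by fun_prop) (by fun_prop) ?_
    intro ξ hξ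
    obtain ⟨η, hη⟩ := hrange ξ hξ
    obtain ⟨η', hη'⟩ := hrange (x ξ) (hx𝒳 ξ hξ)
    have habs : ∀ ζ, absY (absY ζ) = (star y * y) ζ := fun ζ => by rw [← habsY]; rfl
    have e1 : θ ξ = y (absY η) := by rw [← hη, ← habs, hθ']
    have e2 : θ (x ξ) = y (absY η') := by rw [← hη', ← habs, hθ']
    have i1 := hint η
    have i2 := hint η'
    rw [ContinuousLinearMap.integral_apply hFint]
    have e3 : ∀ t, F t ξ = (x * y) (t ^ (p - 1) • R t ((star y * y) η))
        - y (t ^ (p - 1) • R t ((star y * y) η')) := by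
      intro t
      rw [hη, hη']
      simp only [hF, hG]
      simp [smul_sub]
    simp_rw [e3]
    rw [integral_sub ((x * y).integrable_comp i1) (y.integrable_comp i2),
      (x * y).integral_comp_comm i1, y.integral_comp_comm i2, ← happ, ← happ]
    simp [e1, e2]
  rw [hfin]
  exact hcpt

end Helpers


/-- The polar-decomposition/commutator statement (Proposition on polar decompositions,
specialized to the base C*-algebra `ℂ`, i.e. to Hilbert spaces).  Here `absY` is the
(unique) positive square root `|y|` of `y*y`, `sqrtK` is the positive square root of the
positive compact operator `K`, `res λ` is the inverse `(λ + y*y)⁻¹` and `sqrtRes λ` its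
positive square root `(λ + y*y)^{-1/2}`.  The conclusion: the densely defined operator
`y|y|⁻¹ : Im(|y|) → X` extends to a bounded isometry `θ` whose commutators `[x, θ]` and
`[x*, θ]` are compact. -/
theorem stmt_14 {X : Type*}
    [NormedAddCommGroup X] [InnerProductSpace ℂ X] [CompleteSpace X]
    (x y : X →L[ℂ] X)
    (𝒳 : Submodule ℂ X) (hdense : Dense (𝒳 : Set X))
    (h𝒳range : (𝒳 : Set X) ⊆ Set.range (adjoint y ∘L y))
    (hx𝒳 : ∀ ξ ∈ 𝒳, x ξ ∈ 𝒳)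
    (hxadj𝒳 : ∀ ξ ∈ 𝒳, adjoint x ξ ∈ 𝒳)
    (hyadj𝒳 : ∀ ξ ∈ 𝒳, adjoint y ξ ∈ 𝒳)
    (K : X →L[ℂ] X) (hKpos : K.IsPositive) (hKcpt : IsCompactOperator K)
    (sqrtK : X →L[ℂ] X) (hsqrtKpos : sqrtK.IsPositive) (hsqrtK : sqrtK ∘L sqrtK = K)
    (absY : X →L[ℂ] X) (habsYpos : absY.IsPositive)
    (habsY : absY ∘L absY = adjoint y ∘L y)
    (L Lbar M Mbar : X →L[ℂ] X)
    (hL : sqrtK ∘L L ∘L sqrtK = x ∘L y - y ∘L x)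
    (hLbar : sqrtK ∘L Lbar ∘L sqrtK = x ∘L adjoint y - adjoint y ∘L x)
    (hM : M ∘L K = x ∘L y - y ∘L x)
    (hMbar : K ∘L Mbar = x ∘L adjoint y - adjoint y ∘L x)
    (res sqrtRes : ℝ → (X →L[ℂ] X))
    (hres : ∀ l : ℝ, 0 < l →
      ((l : ℂ) • (1 : X →L[ℂ] X) + adjoint y ∘L y) ∘L res l = 1 ∧
        res l ∘L ((l : ℂ) • (1 : X →L[ℂ] X) + adjoint y ∘L y) = 1)
    (hsqrtRes : ∀ l : ℝ, 0 < l →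
      (sqrtRes l).IsPositive ∧ sqrtRes l ∘L sqrtRes l = res l)
    (C : ℝ) (hC : 0 < C)
    (hbound : ∀ l : ℝ, 0 < l →
      ‖sqrtK ∘L sqrtRes l‖ ≤ C ∧ ‖K ∘L res l‖ ≤ C ∧ ‖sqrtK ∘L y ∘L res l‖ ≤ C) :
    ∃ θ : X →L[ℂ] X,
      (∀ ξ : X, ‖θ ξ‖ = ‖ξ‖) ∧
      (∀ ξ : X, θ (absY ξ) = y ξ) ∧
      IsCompactOperator (x ∘L θ - θ ∘L x) ∧
      IsCompactOperator (adjoint x ∘L θ - θ ∘L adjoint x) := by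
  have hsqsa : star sqrtK = sqrtK := hsqrtKpos.isSelfAdjoint
  have hKsa : star K = K := hKpos.isSelfAdjoint
  have habssa : adjoint absY = absY := habsYpos.isSelfAdjoint
  have hnorm : ∀ ξ, ‖absY ξ‖ = ‖y ξ‖ := by
    intro ξ
    have h1 : inner ℂ (absY ξ) (absY ξ) = inner ℂ (y ξ) (y ξ) := by
      rw [← adjoint_inner_left, ← adjoint_inner_left, habssa]
      exact congrArg (fun T : X →L[ℂ] X => inner ℂ (T ξ) ξ) habsY
    rw [inner_self_eq_norm_sq_to_K, inner_self_eq_norm_sq_to_K] at h1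
    have h2 : ‖absY ξ‖ ^ 2 = ‖y ξ‖ ^ 2 := by exact_mod_cast h1
    exact (sq_eq_sq₀ (norm_nonneg _) (norm_nonneg _)).1 h2
  have hdr : DenseRange (absY : X →ₗ[ℂ] X) := by
    refine hdense.mono ?_
    intro ξ hξ
    obtain ⟨η, hη⟩ := h𝒳range hξ
    refine ⟨absY η, ?_⟩
    rw [← hη, ← habsY]
    rfl
  let θ : X →L[ℂ] X := (y : X →ₗ[ℂ] X).extendOfNorm (absY : X →ₗ[ℂ] X)
  have hθ : ∀ ξ, θ (absY ξ) = y ξ := fun ξ =>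
    LinearMap.extendOfNorm_eq hdr ⟨1, fun ζ => by simp [hnorm]⟩ ξ
  have hθ2 : θ * absY = y := by ext ξ; exact hθ ξ
  have hR1 : ∀ t : ℝ, 0 < t → (t • (1 : X →L[ℂ] X) + star y * y) * res t = 1 :=
    fun t ht => (hres t ht).1
  have hR2 : ∀ t : ℝ, 0 < t → res t * (t • (1 : X →L[ℂ] X) + star y * y) = 1 :=
    fun t ht => (hres t ht).2
  have hSsa : ∀ t : ℝ, 0 < t → star (sqrtRes t) = sqrtRes t :=
    fun t ht => (hsqrtRes t ht).1.isSelfAdjoint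
  have hSS : ∀ t : ℝ, 0 < t → sqrtRes t * sqrtRes t = res t := fun t ht => (hsqrtRes t ht).2
  have hb1 : ∀ t : ℝ, 0 < t → ‖sqrtK * sqrtRes t‖ ≤ C := fun t ht => (hbound t ht).1
  have hb2 : ∀ t : ℝ, 0 < t → ‖K * res t‖ ≤ C := fun t ht => (hbound t ht).2.1
  have hb3 : ∀ t : ℝ, 0 < t → ‖sqrtK * y * res t‖ ≤ C := fun t ht => (hbound t ht).2.2
  have hrange : ∀ ξ ∈ 𝒳, ∃ η, (star y * y) η = ξ := fun ξ hξ => h𝒳range hξ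
  have hL' : sqrtK * L * sqrtK = x * y - y * x := hL
  have hLbar' : sqrtK * Lbar * sqrtK = x * star y - star y * x := hLbar
  have hM' : M * K = x * y - y * x := hM
  have hMbar' : K * Mbar = x * star y - star y * x := hMbar
  refine ⟨θ, ?_, hθ, ?_, ?_⟩
  · intro ξ
    refine hdr.induction_on (p := fun ξ => ‖θ ξ‖ = ‖ξ‖) ξ
      (isClosed_eq (by fun_prop) (by fun_prop)) ?_
    intro ζ
    exact (congrArg norm (hθ ζ)).trans (hnorm ζ).symm
  · exact aux_key x y 𝒳 hdense hrange hx𝒳 K hKcpt sqrtK hsqsa absY habsYpos habsY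
      Lbar M Mbar hLbar' hM' hMbar' res sqrtRes hR1 hR2 hSsa hSS C hC hb1 hb2 hb3 θ hθ2
  · refine aux_key (star x) y 𝒳 hdense hrange hxadj𝒳 K hKcpt sqrtK hsqsa absY habsYpos habsY
      (-star L) (-star Mbar) (-star M) ?_ ?_ ?_ res sqrtRes hR1 hR2 hSsa hSS C hC hb1 hb2 hb3 θ hθ2
    · have := congrArg star hL'
      simp only [star_mul, star_sub, hsqsa] at this
      rw [mul_neg, neg_mul, mul_assoc, this]; abel
    · have := congrArg star hMbar'
      simp only [star_mul, star_sub, hKsa, star_star] at this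
      rw [neg_mul, this]; abel
    · have := congrArg star hM'
      simp only [star_mul, star_sub, hKsa] at this
      rw [mul_neg, this]; abel
end
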